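/- Let n ≥ 0 and let (A^•, d, δ) be a bounded (d,δ)-complex of finite-dimensional vector spaces over a field K with A^h = 0 unless 0 ≤ h ≤ 2n, and assume dim_K H_δ^h = dim_K H_d^{2n−h} for every h (as holds for the forms of a compact symplectic 2n-manifold via the symplectic Hodge star operator). Then for each residue class k modulo 2: Σ_{h ≡ k (mod 2)} dim_K H_BC^h ≤ 2(2n+1) · Σ_{h ∈ ℤ} dim_K H_d^h. (Algebraic form of the Angella–Tardini upper bound for the symplectic Bott-Chern numbers in terms of the Betti numbers.) -/

import Mathlib

open LinearMap Submodule Module DirectSum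

namespace Paper

section DoubleComplex

variable (K : Type) [Field K]
variable (A : ℤ → ℤ → Type) [∀ p q, AddCommGroup (A p q)] [∀ p q, Module K (A p q)]

/-- Transport along equalities of the indices. -/
def dcCast {p q p' q' : ℤ} (h1 : p = p') (h2 : q = q') : A p q ≃ₗ[K] A p' q' := by
  subst h1; subst h2; exact LinearEquiv.refl K (A p q)

variable (d1 : ∀ p q : ℤ, A p q →ₗ[K] A (p + 1) q)
variable (d2 : ∀ p q : ℤ, A p q →ₗ[K] A p (q + 1))

/-- The operator ∂∂̄ : A^{p,q} → A^{p+1,q+1} (apply ∂̄ first, then ∂). -/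
def ddBar (p q : ℤ) : A p q →ₗ[K] A (p + 1) (q + 1) := (d1 p (q + 1)).comp (d2 p q)

/-- The image ∂∂̄(A^{p-1,q-1}) inside A^{p,q}. -/
def ddBarIm (p q : ℤ) : Submodule K (A p q) :=
  range ((dcCast K A (show p - 1 + 1 = p by ring) (show q - 1 + 1 = q by ring)).toLinearMap.comp
    (ddBar K A d1 d2 (p - 1) (q - 1)))

/-- Bott-Chern cohomology H_BC^{p,q} = (ker ∂ ∩ ker ∂̄)/∂∂̄(A^{p-1,q-1}). -/
abbrev HBC (p q : ℤ) :=
  ↥(ker (d1 p q) ⊓ ker (d2 p q)) ⧸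
    ((ddBarIm K A d1 d2 p q).comap (ker (d1 p q) ⊓ ker (d2 p q)).subtype)

noncomputable def hBC (p q : ℤ) : ℕ := finrank K (HBC K A d1 d2 p q)

/-- ∂(A^{p-1,q}) + ∂̄(A^{p,q-1}) inside A^{p,q}. -/
def aDen (p q : ℤ) : Submodule K (A p q) :=
  range ((dcCast K A (show p - 1 + 1 = p by ring) rfl).toLinearMap.comp (d1 (p - 1) q)) ⊔
  range ((dcCast K A rfl (show q - 1 + 1 = q by ring)).toLinearMap.comp (d2 p (q - 1)))

/-- Aeppli cohomology H_A^{p,q} = ker ∂∂̄ / (im ∂ + im ∂̄). -/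
abbrev HA (p q : ℤ) :=
  ↥(ker (ddBar K A d1 d2 p q)) ⧸ ((aDen K A d1 d2 p q).comap (ker (ddBar K A d1 d2 p q)).subtype)

noncomputable def hA (p q : ℤ) : ℕ := finrank K (HA K A d1 d2 p q)

/-- Column (Dolbeault) cohomology H_∂̄^{p,q}. -/
abbrev HDolb (p q : ℤ) :=
  ↥(ker (d2 p q)) ⧸
    ((range ((dcCast K A rfl (show q - 1 + 1 = q by ring)).toLinearMap.comp (d2 p (q - 1)))).comap
      (ker (d2 p q)).subtype)

noncomputable def hDolb (p q : ℤ) : ℕ := finrank K (HDolb K A d2 p q)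

/-- Row cohomology H_∂^{p,q}. -/
abbrev HRow (p q : ℤ) :=
  ↥(ker (d1 p q)) ⧸
    ((range ((dcCast K A (show p - 1 + 1 = p by ring) rfl).toLinearMap.comp (d1 (p - 1) q))).comap
      (ker (d1 p q)).subtype)

noncomputable def hRow (p q : ℤ) : ℕ := finrank K (HRow K A d1 p q)

/-- Total complex Tot^k = ⊕_{p+q=k} A^{p,q}. -/
abbrev Tot (k : ℤ) := ⨁ p : ℤ, A p (k - p)

/-- Total differential d = ∂ + ∂̄ on the total complex. -/
noncomputable def totD (k : ℤ) : Tot A k →ₗ[K] Tot A (k + 1) :=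
  DirectSum.toModule K ℤ (Tot A (k + 1)) fun p =>
    ((DirectSum.lof K ℤ (fun p' => A p' (k + 1 - p')) (p + 1)).comp
      ((dcCast K A rfl (show k - p = k + 1 - (p + 1) by ring)).toLinearMap.comp (d1 p (k - p))))
    +
    ((DirectSum.lof K ℤ (fun p' => A p' (k + 1 - p')) p).comp
      ((dcCast K A rfl (show k - p + 1 = k + 1 - p by ring)).toLinearMap.comp (d2 p (k - p))))

def totCast {k k' : ℤ} (h : k = k') : Tot A k ≃ₗ[K] Tot A k' := by
  subst h; exact LinearEquiv.refl K (Tot A k)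

/-- b_k = dim H^k(Tot, d). -/
noncomputable def bNum (k : ℤ) : ℕ :=
  finrank K
    (↥(ker (totD K A d1 d2 k)) ⧸
      ((range ((totCast K A (show k - 1 + 1 = k by ring)).toLinearMap.comp
        (totD K A d1 d2 (k - 1)))).comap (ker (totD K A d1 d2 k)).subtype))

/-- The ∂∂̄-lemma: ker ∂ ∩ ker ∂̄ ∩ (im ∂ + im ∂̄) ⊆ im ∂∂̄ in each bidegree. -/
def DDbarLemma : Prop :=
  ∀ p q : ℤ, (ker (d1 p q) ⊓ ker (d2 p q)) ⊓ aDen K A d1 d2 p q ≤ ddBarIm K A d1 d2 p q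

end DoubleComplex

/-- The map between sub-quotients induced by the identity. -/
def qMap (K : Type) [Field K] {V : Type} [AddCommGroup V] [Module K V]
    {N1 N2 M1 M2 : Submodule K V} (hN : N1 ≤ N2) (hM : M1 ≤ M2) :
    (↥N1 ⧸ M1.comap N1.subtype) →ₗ[K] (↥N2 ⧸ M2.comap N2.subtype) :=
  Submodule.mapQ _ _ (Submodule.inclusion hN) (by
    intro x hx
    simp only [Submodule.mem_comap, Submodule.coe_subtype] at hx ⊢
    simpa using hM hx)

section SComplex

variable (K : Type) [Field K]
variable (A : ℤ → Type) [∀ k, AddCommGroup (A k)] [∀ k, Module K (A k)]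

def sCast {k k' : ℤ} (h : k = k') : A k ≃ₗ[K] A k' := by
  subst h; exact LinearEquiv.refl K (A k)

variable (d : ∀ k : ℤ, A k →ₗ[K] A (k + 1))
variable (dl : ∀ k : ℤ, A k →ₗ[K] A (k - 1))

/-- The degree-0 operator dδ : A^k → A^k (apply δ first, then d). -/
def dDelta (k : ℤ) : A k →ₗ[K] A k :=
  (sCast K A (show k - 1 + 1 = k by ring)).toLinearMap.comp ((d (k - 1)).comp (dl k))

/-- Symplectic-type Bott-Chern cohomology H_BC^k = (ker d ∩ ker δ)/dδ(A^k). -/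
abbrev HBCs (k : ℤ) :=
  ↥(ker (d k) ⊓ ker (dl k)) ⧸
    ((range (dDelta K A d dl k)).comap (ker (d k) ⊓ ker (dl k)).subtype)

noncomputable def hBCs (k : ℤ) : ℕ := finrank K (HBCs K A d dl k)

/-- d(A^{k-1}) + δ(A^{k+1}) inside A^k. -/
def sDen (k : ℤ) : Submodule K (A k) :=
  range ((sCast K A (show k - 1 + 1 = k by ring)).toLinearMap.comp (d (k - 1))) ⊔
  range ((sCast K A (show k + 1 - 1 = k by ring)).toLinearMap.comp (dl (k + 1)))

/-- Symplectic-type Aeppli cohomology H_A^k = ker dδ / (im d + im δ). -/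
abbrev HAs (k : ℤ) :=
  ↥(ker (dDelta K A d dl k)) ⧸ ((sDen K A d dl k).comap (ker (dDelta K A d dl k)).subtype)

noncomputable def hAs (k : ℤ) : ℕ := finrank K (HAs K A d dl k)

/-- H_d^k = ker d / im d. -/
abbrev Hds (k : ℤ) :=
  ↥(ker (d k)) ⧸
    ((range ((sCast K A (show k - 1 + 1 = k by ring)).toLinearMap.comp (d (k - 1)))).comap
      (ker (d k)).subtype)

noncomputable def hds (k : ℤ) : ℕ := finrank K (Hds K A d k)

/-- H_δ^k = ker δ / im δ. -/
abbrev Hdls (k : ℤ) :=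
  ↥(ker (dl k)) ⧸
    ((range ((sCast K A (show k + 1 - 1 = k by ring)).toLinearMap.comp (dl (k + 1)))).comap
      (ker (dl k)).subtype)

noncomputable def hdls (k : ℤ) : ℕ := finrank K (Hdls K A dl k)

/-- The dδ-lemma: ker d ∩ ker δ ∩ (im d + im δ) ⊆ im dδ in each degree. -/
def DDeltaLemma : Prop :=
  ∀ k : ℤ, (ker (d k) ⊓ ker (dl k)) ⊓ sDen K A d dl k ≤ range (dDelta K A d dl k)

/-- The strip double complex B^{p,q} = A^{p-q}. -/
abbrev strip (p q : ℤ) := A (p - q)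

/-- ∂ on the strip double complex, given by d. -/
def stripD1 (p q : ℤ) : strip A p q →ₗ[K] strip A (p + 1) q :=
  (sCast K A (show p - q + 1 = p + 1 - q by ring)).toLinearMap.comp (d (p - q))

/-- ∂̄ on the strip double complex, given by δ. -/
def stripD2 (p q : ℤ) : strip A p q →ₗ[K] strip A p (q + 1) :=
  (sCast K A (show p - q - 1 = p - (q + 1) by ring)).toLinearMap.comp (dl (p - q))

end SComplex

section Algebra

variable {K : Type} [Field K]

theorem finrank_subquotient_add {V : Type} [AddCommGroup V] [Module K V] [FiniteDimensional K V]
    {M N : Submodule K V} (h : M ≤ N) :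
    finrank K (↥N ⧸ M.comap N.subtype) + finrank K M = finrank K N := by
  rw [← (Submodule.comapSubtypeEquivOfLe h).finrank_eq]
  exact Submodule.finrank_quotient_add_finrank _

theorem finrank_map_add_finrank_inf_ker {V W : Type} [AddCommGroup V] [Module K V]
    [FiniteDimensional K V] [AddCommGroup W] [Module K W] (f : V →ₗ[K] W) (P : Submodule K V) :
    finrank K (P.map f) + finrank K ↥(P ⊓ ker f) = finrank K P := by
  have h := LinearMap.finrank_range_add_finrank_ker (f.domRestrict P)
  rw [LinearMap.range_domRestrict, LinearMap.ker_domRestrict] at h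
  have h2 : finrank K ↥((ker f).comap P.subtype) = finrank K ↥(P ⊓ ker f) := by
    rw [← Submodule.map_comap_subtype]
    exact (Submodule.finrank_map_subtype_eq P _).symm
  rw [← h2]
  exact h

theorem finrank_inf_add_le {V : Type} [AddCommGroup V] [Module K V] [FiniteDimensional K V]
    {M N : Submodule K V} (h : M ≤ N) (P : Submodule K V) :
    finrank K ↥(N ⊓ P) + finrank K M ≤ finrank K N + finrank K ↥(M ⊓ P) := by
  have h1 := Submodule.finrank_sup_add_finrank_inf_eq M (N ⊓ P)
  have h2 : M ⊓ (N ⊓ P) = M ⊓ P := by rw [← inf_assoc, inf_eq_left.mpr h]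
  have h3 : finrank K ↥(M ⊔ N ⊓ P) ≤ finrank K N :=
    Submodule.finrank_mono (sup_le h inf_le_left)
  rw [h2] at h1
  omega

/-- Two-step comparison for `V₂ ⇄ V₁ ⇄ V₀`, where `a`, `b` are the differentials raising the
degree, `c`, `f` those lowering it, and `S` is the image of the differential into `V₂`. -/
theorem finrank_range_inf_ker_step {V₀ V₁ V₂ W : Type}
    [AddCommGroup V₀] [Module K V₀] [FiniteDimensional K V₀]
    [AddCommGroup V₁] [Module K V₁] [FiniteDimensional K V₁]
    [AddCommGroup V₂] [Module K V₂] [FiniteDimensional K V₂]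
    [AddCommGroup W] [Module K W]
    (a : V₂ →ₗ[K] V₁) (b : V₁ →ₗ[K] V₀) (c : V₀ →ₗ[K] V₁) (f : V₁ →ₗ[K] V₂) (g : V₂ →ₗ[K] W)
    (S : Submodule K V₂) (hS : S ≤ ker a)
    (hba : ∀ x, b (a x) = 0) (hfc : ∀ x, f (c x) = 0) (hgf : ∀ x, g (f x) = 0)
    (hac : ∀ x, c (b x) + a (f x) = 0) :
    finrank K ↥(range b ⊓ ker c) + finrank K (range (f.comp a)) + finrank K S
        + finrank K (range c) ≤
      finrank K ↥(S ⊓ ker g) + finrank K (ker a) + finrank K (ker f)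
        + finrank K (range (b.comp c)) := by
  have hP : ∀ x, x ∈ ker (c.comp b) ↔ a (f x) = 0 := fun x => by
    rw [LinearMap.mem_ker, LinearMap.comp_apply]
    constructor <;> intro h <;> simpa [h] using hac x
  have hbP : (ker (c.comp b)).map b = range b ⊓ ker c := by
    rw [LinearMap.ker_comp, Submodule.map_comap_eq]
  have hfP : (ker (c.comp b)).map f ≤ ker a ⊓ ker g := by
    rintro _ ⟨x, hx, rfl⟩
    exact ⟨(hP x).1 hx, hgf x⟩
  have hbk : ker (c.comp b) ⊓ ker b = ker b := inf_eq_right.mpr (LinearMap.ker_le_ker_comp b c)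
  have hfk : ker (c.comp b) ⊓ ker f = ker f := inf_eq_right.mpr fun x hx => by
    rw [hP, LinearMap.mem_ker.1 hx, map_zero]
  have e1 := finrank_map_add_finrank_inf_ker b (ker (c.comp b))
  have e2 := finrank_map_add_finrank_inf_ker f (ker (c.comp b))
  rw [hbP, hbk] at e1
  rw [hfk] at e2
  have e3 := Submodule.finrank_mono hfP
  have e4 := finrank_inf_add_le hS (ker g)
  have e5 := finrank_map_add_finrank_inf_ker b (range c)
  rw [← LinearMap.range_comp] at e5
  have e6 := finrank_map_add_finrank_inf_ker f (ker b)
  have e7 : finrank K (range (f.comp a)) ≤ finrank K ((ker b).map f) := by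
    rw [LinearMap.range_comp]
    refine Submodule.finrank_mono (Submodule.map_mono ?_)
    rintro _ ⟨x, rfl⟩
    exact hba x
  have e8 : finrank K ↥(range c ⊓ ker b) ≤ finrank K ↥(ker b ⊓ ker f) := by
    refine Submodule.finrank_mono ?_
    rintro _ ⟨⟨x, rfl⟩, hx⟩
    exact ⟨hx, hfc x⟩
  omega

end Algebra

section Graded

variable (K : Type) [Field K]
variable (A : ℤ → Type) [∀ k, AddCommGroup (A k)] [∀ k, Module K (A k)]
variable (d : ∀ k : ℤ, A k →ₗ[K] A (k + 1))
variable (dl : ∀ k : ℤ, A k →ₗ[K] A (k - 1))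

/-- The image of `d` in degree `k`. -/
def dIm (k : ℤ) : Submodule K (A k) :=
  range ((sCast K A (show k - 1 + 1 = k by ring)).toLinearMap.comp (d (k - 1)))

/-- The image of `δ` in degree `k`. -/
def dlIm (k : ℤ) : Submodule K (A k) :=
  range ((sCast K A (show k + 1 - 1 = k by ring)).toLinearMap.comp (dl (k + 1)))

/-- The dimension of `(im d ∩ ker δ) / im dδ` in degree `k`. -/
noncomputable def excess (k : ℤ) : ℕ :=
  finrank K ↥(dIm K A d k ⊓ ker (dl k)) - finrank K (range (dDelta K A d dl k))

theorem sCast_d {i j : ℤ} (h : i = j) (h' : i + 1 = j + 1) (x : A i) :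
    sCast K A h' (d i x) = d j (sCast K A h x) := by
  subst h; rfl

theorem sCast_dl {i j : ℤ} (h : i = j) (h' : i - 1 = j - 1) (x : A i) :
    sCast K A h' (dl i x) = dl j (sCast K A h x) := by
  subst h; rfl

theorem sCast_sCast {i j l : ℤ} (h : i = j) (h' : j = l) (x : A i) :
    sCast K A h' (sCast K A h x) = sCast K A (h.trans h') x := by
  subst h; subst h'; rfl

theorem range_sCast_comp_d {i j : ℤ} (h : i = j) (h' : i + 1 = j + 1) :
    range ((sCast K A h').toLinearMap.comp (d i)) = range (d j) := by
  subst h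
  rfl

theorem dIm_add_one (j : ℤ) : dIm K A d (j + 1) = range (d j) :=
  range_sCast_comp_d K A d (by ring) _

variable {K A d dl}

theorem dIm_le_ker (hdd : ∀ (k : ℤ) (x : A k), d (k + 1) (d k x) = 0) (k : ℤ) :
    dIm K A d k ≤ ker (d k) := by
  rintro _ ⟨x, rfl⟩
  have h := sCast_d K A d (show k - 1 + 1 = k by ring) (by ring) (d (k - 1) x)
  rw [hdd, map_zero] at h
  exact h.symm

theorem dlIm_le_ker (hdldl : ∀ (k : ℤ) (x : A k), dl (k - 1) (dl k x) = 0) (k : ℤ) :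
    dlIm K A dl k ≤ ker (dl k) := by
  rintro _ ⟨x, rfl⟩
  have h := sCast_dl K A dl (show k + 1 - 1 = k by ring) (by ring) (dl (k + 1) x)
  rw [hdldl, map_zero] at h
  exact h.symm

theorem dDelta_eq_neg
    (hanti : ∀ (k : ℤ) (x : A k),
      sCast K A (show k + 1 - 1 = k - 1 + 1 by ring) (dl (k + 1) (d k x)) + d (k - 1) (dl k x) = 0)
    (k : ℤ) (x : A k) :
    sCast K A (show k + 1 - 1 = k by ring) (dl (k + 1) (d k x)) + dDelta K A d dl k x = 0 := by
  have h := congrArg (sCast K A (show k - 1 + 1 = k by ring)) (hanti k x)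
  rw [map_add, map_zero, sCast_sCast] at h
  exact h

theorem dDelta_succ (j : ℤ) (x : A (j + 1)) :
    dDelta K A d dl (j + 1) x = d j (sCast K A (show j + 1 - 1 = j by ring) (dl (j + 1) x)) :=
  sCast_d K A d (by ring) _ _

theorem excess_eq_zero_of_subsingleton {k : ℤ} (h : Subsingleton (A k)) :
    excess K A d dl k = 0 := by
  unfold excess
  rw [Module.finrank_zero_of_subsingleton, Nat.zero_sub]

variable [∀ k, FiniteDimensional K (A k)]

theorem hds_add_finrank (hdd : ∀ (k : ℤ) (x : A k), d (k + 1) (d k x) = 0) (k : ℤ) :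
    hds K A d k + finrank K (dIm K A d k) = finrank K (ker (d k)) :=
  finrank_subquotient_add (dIm_le_ker hdd k)

theorem hdls_add_finrank (hdldl : ∀ (k : ℤ) (x : A k), dl (k - 1) (dl k x) = 0) (k : ℤ) :
    hdls K A dl k + finrank K (dlIm K A dl k) = finrank K (ker (dl k)) :=
  finrank_subquotient_add (dlIm_le_ker hdldl k)

theorem excess_add_two_le
    (hdd : ∀ (k : ℤ) (x : A k), d (k + 1) (d k x) = 0)
    (hdldl : ∀ (k : ℤ) (x : A k), dl (k - 1) (dl k x) = 0)
    (hanti : ∀ (k : ℤ) (x : A k),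
      sCast K A (show k + 1 - 1 = k - 1 + 1 by ring) (dl (k + 1) (d k x)) + d (k - 1) (dl k x) = 0)
    (j : ℤ) :
    excess K A d dl (j + 1 + 1) ≤ excess K A d dl j + hds K A d j + hdls K A dl (j + 1) := by
  have key := finrank_range_inf_ker_step (d j) (d (j + 1))
    ((sCast K A (show j + 1 + 1 - 1 = j + 1 by ring)).toLinearMap.comp (dl (j + 1 + 1)))
    ((sCast K A (show j + 1 - 1 = j by ring)).toLinearMap.comp (dl (j + 1)))
    (dl j) (dIm K A d j) (dIm_le_ker hdd j) (hdd j)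
    (fun x => by
      have h := LinearMap.mem_ker.1 (dlIm_le_ker hdldl (j + 1) ⟨x, rfl⟩)
      exact (congrArg (sCast K A _) h).trans (map_zero (sCast K A _)))
    (fun x => dlIm_le_ker hdldl j ⟨x, rfl⟩)
    (fun x => by
      have h := dDelta_eq_neg hanti (j + 1) x
      rw [dDelta_succ] at h
      exact h)
  have h1 := hds_add_finrank hdd j
  have h2 := hdls_add_finrank hdldl (j + 1)
  have r2 : (d (j + 1)).comp
      ((sCast K A (show j + 1 + 1 - 1 = j + 1 by ring)).toLinearMap.comp (dl (j + 1 + 1))) =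
      dDelta K A d dl (j + 1 + 1) := LinearMap.ext fun x => (dDelta_succ (j + 1) x).symm
  have r1 : range (((sCast K A (show j + 1 - 1 = j by ring)).toLinearMap.comp (dl (j + 1))).comp
      (d j)) = range (dDelta K A d dl j) := by
    rw [← LinearMap.range_neg (dDelta K A d dl j)]
    congr 1
    exact LinearMap.ext fun x => eq_neg_of_add_eq_zero_left (dDelta_eq_neg hanti j x)
  rw [r2, r1, LinearEquiv.ker_comp, LinearEquiv.ker_comp, ← dIm_add_one] at key
  unfold excess
  unfold dlIm at h2
  omega

theorem hBCs_le
    (hdd : ∀ (k : ℤ) (x : A k), d (k + 1) (d k x) = 0)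
    (hdldl : ∀ (k : ℤ) (x : A k), dl (k - 1) (dl k x) = 0)
    (hanti : ∀ (k : ℤ) (x : A k),
      sCast K A (show k + 1 - 1 = k - 1 + 1 by ring) (dl (k + 1) (d k x)) + d (k - 1) (dl k x) = 0)
    (k : ℤ) : hBCs K A d dl k ≤ hds K A d k + excess K A d dl k := by
  have hle : range (dDelta K A d dl k) ≤ ker (d k) ⊓ ker (dl k) := by
    rintro _ ⟨x, rfl⟩
    refine ⟨dIm_le_ker hdd k ⟨dl k x, rfl⟩, ?_⟩
    rw [eq_neg_of_add_eq_zero_right (dDelta_eq_neg hanti k x)]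
    exact neg_mem (dlIm_le_ker hdldl k ⟨d k x, rfl⟩)
  have h1 : hBCs K A d dl k + _ = _ := finrank_subquotient_add hle
  have h2 := finrank_inf_add_le (dIm_le_ker hdd k) (ker (dl k))
  have h3 := hds_add_finrank hdd k
  unfold excess
  omega

theorem excess_le_sum
    (hdd : ∀ (k : ℤ) (x : A k), d (k + 1) (d k x) = 0)
    (hdldl : ∀ (k : ℤ) (x : A k), dl (k - 1) (dl k x) = 0)
    (hanti : ∀ (k : ℤ) (x : A k),
      sCast K A (show k + 1 - 1 = k - 1 + 1 by ring) (dl (k + 1) (d k x)) + d (k - 1) (dl k x) = 0)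
    (hneg : ∀ h : ℤ, h < 0 → Subsingleton (A h)) (N : ℕ) :
    ∀ k : ℤ, k < N →
      excess K A d dl k ≤ ∑ i ∈ Finset.Ico (-2) k, (hds K A d i + hdls K A dl i) := by
  induction N with
  | zero =>
    intro k hk
    rw [excess_eq_zero_of_subsingleton (hneg k (by simpa using hk))]
    exact Nat.zero_le _
  | succ N ih =>
    intro k hk
    rcases lt_or_ge k 0 with hk0 | hk0
    · rw [excess_eq_zero_of_subsingleton (hneg k hk0)]
      exact Nat.zero_le _
    obtain ⟨j, rfl⟩ : ∃ j, k = j + 1 + 1 := ⟨k - 2, by ring⟩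
    have h1 := excess_add_two_le hdd hdldl hanti j
    have h2 := ih j (by push_cast at hk; omega)
    rw [← Finset.insert_Ico_right_eq_Ico_add_one (by omega : (-2 : ℤ) ≤ j + 1),
      ← Finset.insert_Ico_right_eq_Ico_add_one (by omega : (-2 : ℤ) ≤ j),
      Finset.sum_insert (by simp), Finset.sum_insert (by simp)]
    omega

end Graded

theorem symplectic_BC_upper_bound (n : ℕ) (K : Type) [Field K]
    (A : ℤ → Type) [∀ k, AddCommGroup (A k)] [∀ k, Module K (A k)]
    [∀ k, FiniteDimensional K (A k)]
    (d : ∀ k : ℤ, A k →ₗ[K] A (k + 1))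
    (dl : ∀ k : ℤ, A k →ₗ[K] A (k - 1))
    (hsupp : ∀ h : ℤ, (h < 0 ∨ 2 * (n : ℤ) < h) → Subsingleton (A h))
    (hdd : ∀ (k : ℤ) (x : A k), d (k + 1) (d k x) = 0)
    (hdldl : ∀ (k : ℤ) (x : A k), dl (k - 1) (dl k x) = 0)
    (hanti : ∀ (k : ℤ) (x : A k),
      sCast K A (show k + 1 - 1 = k - 1 + 1 by ring) (dl (k + 1) (d k x)) + d (k - 1) (dl k x) = 0)
    (hdual : ∀ h : ℤ, hdls K A dl h = hds K A d (2 * (n : ℤ) - h)) :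
    ∀ k : ℤ,
      (∑ᶠ h : ℤ, if h % 2 = k % 2 then hBCs K A d dl h else 0) ≤
        2 * (2 * n + 1) * ∑ᶠ h : ℤ, hds K A d h := by
  intro k
  have hd0 : ∀ h : ℤ, h ∉ Finset.Ico (-2 : ℤ) (2 * n + 1) → hds K A d h = 0 := fun h hh => by
    have := hsupp h (by simp only [Finset.mem_Ico] at hh; omega)
    have e := hds_add_finrank hdd h
    have e' : finrank K (ker (d h)) = 0 := Module.finrank_zero_of_subsingleton
    omega
  have hl0 : ∀ h : ℤ, h ∉ Finset.Ico (-2 : ℤ) (2 * n + 1) → hdls K A dl h = 0 := fun h hh => by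
    have := hsupp h (by simp only [Finset.mem_Ico] at hh; omega)
    have e := hdls_add_finrank hdldl h
    have e' : finrank K (ker (dl h)) = 0 := Module.finrank_zero_of_subsingleton
    omega
  have sd : ∑ᶠ h : ℤ, hds K A d h = ∑ h ∈ Finset.Ico (-2 : ℤ) (2 * n + 1), hds K A d h :=
    finsum_eq_sum_of_support_subset _ fun h hh => by
      by_contra hc; exact hh (hd0 h (by simpa using hc))
  have sl : ∑ᶠ h : ℤ, hdls K A dl h = ∑ h ∈ Finset.Ico (-2 : ℤ) (2 * n + 1), hdls K A dl h :=
    finsum_eq_sum_of_support_subset _ fun h hh => by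
      by_contra hc; exact hh (hl0 h (by simpa using hc))
  have sdual : ∑ᶠ h : ℤ, hdls K A dl h = ∑ᶠ h : ℤ, hds K A d h := by
    simp only [hdual]
    exact finsum_comp_equiv (Equiv.subLeft (2 * (n : ℤ)))
  have bound : ∀ h ∈ Finset.Ico (0 : ℤ) (2 * n + 1),
      hBCs K A d dl h ≤ 2 * ∑ᶠ h : ℤ, hds K A d h := fun h hh => by
    rw [Finset.mem_Ico] at hh
    have h1 := hBCs_le hdd hdldl hanti h
    have h2 := excess_le_sum hdd hdldl hanti (fun h hh => hsupp h (Or.inl hh)) (2 * n + 1) h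
      (by push_cast; omega)
    have h3 : ∑ i ∈ Finset.Ico (-2) (h + 1), (hds K A d i + hdls K A dl i) ≤
        ∑ i ∈ Finset.Ico (-2 : ℤ) (2 * n + 1), (hds K A d i + hdls K A dl i) :=
      Finset.sum_le_sum_of_subset (Finset.Ico_subset_Ico_right (by omega))
    rw [← Finset.insert_Ico_right_eq_Ico_add_one (by omega : (-2 : ℤ) ≤ h),
      Finset.sum_insert (by simp), Finset.sum_add_distrib (s := Finset.Ico (-2 : ℤ) (2 * n + 1)),
      ← sd, ← sl, sdual] at h3
    omega
  have hBC0 : ∀ h : ℤ, h ∉ Finset.Ico (0 : ℤ) (2 * n + 1) → hBCs K A d dl h = 0 := fun h hh => by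
    have := hsupp h (by simp only [Finset.mem_Ico] at hh; omega)
    exact Module.finrank_zero_of_subsingleton
  rw [finsum_eq_sum_of_support_subset (s := Finset.Ico (0 : ℤ) (2 * n + 1)) _ fun h hh => by
    by_contra hc
    exact hh (by simp only [hBC0 h (by simpa using hc), ite_self])]
  calc _ ≤ ∑ h ∈ Finset.Ico (0 : ℤ) (2 * n + 1), 2 * ∑ᶠ h : ℤ, hds K A d h :=
        Finset.sum_le_sum fun h hh => by
          split_ifs
          · exact bound h hh
          · exact Nat.zero_le _
    _ = 2 * (2 * n + 1) * ∑ᶠ h : ℤ, hds K A d h := by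
        have hc : ((2 * (n : ℤ) + 1) - 0).toNat = 2 * n + 1 := by omega
        rw [Finset.sum_const, Int.card_Ico, hc, smul_eq_mul]
        ring

end Paper
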